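/- Let m ≥ 7 be an odd integer and let n be an integer with n ≥ 2m + 499 and n ≥ 3493. If G is a graph on 3n + 4 vertices that contains no copy of K_{2,n} and whose complement contains no copy of W_m, then the maximum degree of the complement satisfies Δ(G̅) ≤ 2n + 2. -/

import Mathlib

open SimpleGraph

/-- `ContainsCopy Γ H` : `Γ` contains a copy of `H`, i.e. `H` is isomorphic to a subgraph
of `Γ`; equivalently, there is an injective graph homomorphism from `H` to `Γ`. -/
def ContainsCopy {α β : Type*} (Γ : SimpleGraph α) (H : SimpleGraph β) : Prop :=
  ∃ f : H →g Γ, Function.Injective f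

/-- The wheel graph `W_m` on `m+1` vertices: the join of a single hub vertex (`none`)
with the cycle `C_m` (on the vertices `some i`). -/
def wheelGraph (m : ℕ) : SimpleGraph (Option (Fin m)) :=
  SimpleGraph.fromRel (fun x y =>
    x = none ∨ ∃ i j : Fin m, x = some i ∧ y = some j ∧ (SimpleGraph.cycleGraph m).Adj i j)

section

variable {V : Type*}

/-- A closed walk of length `ℓ` in `K`, given as an `ℓ`-periodic sequence of vertices. -/
def IsClosedSeq (K : SimpleGraph V) (ℓ : ℕ) (c : ℕ → V) : Prop :=
  (∀ i, K.Adj (c i) (c (i + 1))) ∧ ∀ i, c (i + ℓ) = c i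

/-- `K` contains a cycle of length `ℓ`. -/
def HasCycle (K : SimpleGraph V) (ℓ : ℕ) : Prop :=
  ∃ c, IsClosedSeq K ℓ c ∧ ∀ i < ℓ, ∀ j < ℓ, c i = c j → i = j

/-- The segment `c s, …, c (s + t - 1)` of a sequence. -/
def arc (c : ℕ → V) (s t : ℕ) : List V := (List.range t).map fun j => c (s + j)

lemma length_arc (c : ℕ → V) (s t : ℕ) : (arc c s t).length = t := by simp [arc]

lemma head?_arc (c : ℕ → V) (s : ℕ) {t : ℕ} (ht : 0 < t) : (arc c s t).head? = some (c s) := by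
  obtain ⟨t, rfl⟩ : ∃ k, t = k + 1 := ⟨t - 1, by omega⟩
  simp [arc, List.range_succ_eq_map]

lemma getLast?_arc (c : ℕ → V) (s : ℕ) {t : ℕ} (ht : 0 < t) :
    (arc c s t).getLast? = some (c (s + t - 1)) := by
  obtain ⟨t, rfl⟩ : ∃ k, t = k + 1 := ⟨t - 1, by omega⟩
  simp [arc, List.range_succ, ← add_assoc]

lemma isChain_arc {K : SimpleGraph V} {c : ℕ → V} (hc : ∀ i, K.Adj (c i) (c (i + 1))) (s t : ℕ) :
    (arc c s t).IsChain K.Adj := by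
  rw [List.isChain_iff_getElem]
  intro i hi
  simp only [arc, List.getElem_map, List.getElem_range, ← add_assoc]
  exact hc _

lemma mem_arc {c : ℕ → V} {s t : ℕ} {x : V} : x ∈ arc c s t ↔ ∃ j < t, c (s + j) = x := by
  simp [arc]

lemma isClosedSeq_of_list {K : SimpleGraph V} {l : List V} (hl : l ≠ []) (hch : l.IsChain K.Adj)
    (hlast : ∀ x ∈ l.getLast?, ∀ y ∈ l.head?, K.Adj x y) :
    ∃ c, IsClosedSeq K l.length c ∧ ∀ i (hi : i < l.length), c i = l[i] := by
  have hpos : 0 < l.length := List.length_pos_of_ne_nil hl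
  refine ⟨fun i => l[i % l.length]'(Nat.mod_lt _ hpos), ⟨fun i => ?_, fun i => ?_⟩, fun i hi => ?_⟩
  · have hi := Nat.mod_lt i hpos
    by_cases h : i % l.length + 1 = l.length
    · have h1 : (i + 1) % l.length = 0 := by
        rw [Nat.add_mod, ← Nat.mod_add_mod]
        simp [h]
      refine hlast _ ?_ _ ?_
      · simp only [List.getLast?_eq_getElem?, Option.mem_def]
        rw [List.getElem?_eq_getElem (by omega)]
        congr 2
        omega
      · simp only [List.head?_eq_getElem?, Option.mem_def, h1]
        rw [List.getElem?_eq_getElem hpos]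
    · have h1 : (i + 1) % l.length = i % l.length + 1 := by
        rw [← Nat.mod_add_mod]
        exact Nat.mod_eq_of_lt (by omega)
      simp only [h1]
      exact List.isChain_iff_getElem.1 hch _ _
  · simp
  · simp [Nat.mod_eq_of_lt hi]

lemma hasCycle_of_list {K : SimpleGraph V} {l : List V} {t : ℕ} (ht : l.length = t) (hl : l ≠ [])
    (hch : l.IsChain K.Adj) (hnd : l.Nodup)
    (hlast : ∀ x ∈ l.getLast?, ∀ y ∈ l.head?, K.Adj x y) : HasCycle K t := by
  subst ht
  obtain ⟨c, hc, hcl⟩ := isClosedSeq_of_list hl hch hlast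
  refine ⟨c, hc, fun i hi j hj h => ?_⟩
  rw [hcl i hi, hcl j hj] at h
  exact (hnd.getElem_inj_iff).1 h

lemma HasCycle.map {W : Type*} {K : SimpleGraph V} {L : SimpleGraph W} {ℓ : ℕ} (f : V → W)
    (hf : Function.Injective f) (hadj : ∀ x y, K.Adj x y → L.Adj (f x) (f y))
    (h : HasCycle K ℓ) : HasCycle L ℓ := by
  obtain ⟨c, ⟨h1, h2⟩, h3⟩ := h
  exact ⟨f ∘ c, ⟨fun i => hadj _ _ (h1 i), fun i => congrArg f (h2 i)⟩,
    fun i hi j hj h => h3 i hi j hj (hf h)⟩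

section CycleExtension

variable {K : SimpleGraph V} {ℓ : ℕ} {c : ℕ → V}

lemma IsClosedSeq.mod (hc : IsClosedSeq K ℓ c) (i : ℕ) : c (i % ℓ) = c i := by
  have : Function.Periodic c ℓ := hc.2
  exact this.map_mod_nat i

lemma IsClosedSeq.eq_iff (hc : IsClosedSeq K ℓ c) (hℓ : 0 < ℓ)
    (hinj : ∀ i < ℓ, ∀ j < ℓ, c i = c j → i = j) (i j : ℕ) : c i = c j ↔ i % ℓ = j % ℓ := by
  rw [← hc.mod i, ← hc.mod j]
  exact ⟨fun h => hinj _ (Nat.mod_lt _ hℓ) _ (Nat.mod_lt _ hℓ) h, fun h => by rw [h]⟩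

lemma IsClosedSeq.eq_of_le (hc : IsClosedSeq K ℓ c)
    (hinj : ∀ i < ℓ, ∀ j < ℓ, c i = c j → i = j) {s i j : ℕ} (hi : s ≤ i) (hi' : i < s + ℓ)
    (hj : s ≤ j) (hj' : j < s + ℓ) (h : c i = c j) : i = j := by
  rw [hc.eq_iff (by omega) hinj] at h
  have h2 : ∀ i j, i ≤ j → s ≤ i → j < s + ℓ → i % ℓ = j % ℓ → i = j := by
    intro i j hij hi hj h
    have := (Nat.modEq_iff_dvd' hij).1 h
    have := Nat.eq_zero_of_dvd_of_lt this (by omega)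
    omega
  rcases le_total i j with hij | hij
  · exact h2 i j hij hi hj' h
  · exact (h2 j i hij hj hi' h.symm).symm

lemma IsClosedSeq.nodup_arc (hc : IsClosedSeq K ℓ c)
    (hinj : ∀ i < ℓ, ∀ j < ℓ, c i = c j → i = j) (s : ℕ) {t : ℕ} (ht : t ≤ ℓ) :
    (arc c s t).Nodup := by
  refine List.Nodup.map_on ?_ List.nodup_range
  intro x hx y hy h
  rw [List.mem_range] at hx hy
  have := hc.eq_of_le hinj (s := s) (by omega) (by omega) (by omega) (by omega) h
  omega

lemma IsClosedSeq.nodup_arc_append (hc : IsClosedSeq K ℓ c)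
    (hinj : ∀ i < ℓ, ∀ j < ℓ, c i = c j → i = j) (s t : ℕ) {r : ℕ} (h : t + r ≤ ℓ) :
    (arc c s t).Disjoint (arc c (s + t) r) := by
  intro x hx hy
  obtain ⟨i, hi, rfl⟩ := mem_arc.1 hx
  obtain ⟨j, hj, hij⟩ := mem_arc.1 hy
  have := hc.eq_of_le hinj (s := s) (by omega) (by omega) (by omega) (by omega) hij
  omega

lemma hasCycle_insert_insert (hc : IsClosedSeq K ℓ c)
    (hinj : ∀ i < ℓ, ∀ j < ℓ, c i = c j → i = j)
    {b b' : V} (hbb : b ≠ b') (hb : ∀ i, c i ≠ b) (hb' : ∀ i, c i ≠ b')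
    {i k : ℕ} (hik : i < k) (hk : k < ℓ) (h1 : K.Adj b (c i)) (h2 : K.Adj b (c (i + 1)))
    (h3 : K.Adj b' (c k)) (h4 : K.Adj b' (c (k + 1))) : HasCycle K (ℓ + 2) := by
  have e1 : i + 1 + (k - i) - 1 = k := by omega
  have e2 : k + 1 + (ℓ - k + i) - 1 = i + ℓ := by omega
  have e3 : i + 1 + (k - i) = k + 1 := by omega
  have hd := hc.nodup_arc_append hinj (i + 1) (k - i) (r := ℓ - k + i) (by omega)
  rw [e3] at hd
  have n1 := hc.nodup_arc hinj (i + 1) (t := k - i) (by omega)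
  have n2 := hc.nodup_arc hinj (k + 1) (t := ℓ - k + i) (by omega)
  have hh1 := head?_arc c (i + 1) (t := k - i) (by omega)
  have hh2 := head?_arc c (k + 1) (t := ℓ - k + i) (by omega)
  have hl1 := getLast?_arc c (i + 1) (t := k - i) (by omega)
  have hl2 := getLast?_arc c (k + 1) (t := ℓ - k + i) (by omega)
  have hp := hc.2 i
  refine hasCycle_of_list (l := b :: (arc c (i + 1) (k - i) ++ b' :: arc c (k + 1) (ℓ - k + i)))
    ?_ (by simp) ?_ ?_ ?_
  · simp [length_arc]; omega
  · simp only [List.isChain_cons, List.isChain_append, isChain_arc hc.1]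
    simp [hh1, hh2, hl1, e1, h2, h3.symm, h4]
  · simp only [List.nodup_cons, List.nodup_append', n1, n2]
    simp [mem_arc, hb, hb', hbb, hd]
  · simp [List.getLast?_cons, List.getLast?_append, hl2, e2, hp, h1.symm]

lemma hasCycle_cross (hc : IsClosedSeq K ℓ c)
    (hinj : ∀ i < ℓ, ∀ j < ℓ, c i = c j → i = j)
    {b b' : V} (hbb : b ≠ b') (hb : ∀ i, c i ≠ b) (hb' : ∀ i, c i ≠ b')
    {i k : ℕ} (hik : i < k) (hk : k < ℓ) (h1 : K.Adj b (c i)) (h2 : K.Adj b (c k))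
    (h3 : K.Adj b' (c (i + 1))) (h4 : K.Adj b' (c (k + 1))) : HasCycle K (ℓ + 2) := by
  have e1 : i + 1 + (k - i) - 1 = k := by omega
  have e2 : k + 1 + (ℓ - k + i) - 1 = i + ℓ := by omega
  have e3 : i + 1 + (k - i) = k + 1 := by omega
  have hd := hc.nodup_arc_append hinj (i + 1) (k - i) (r := ℓ - k + i) (by omega)
  rw [e3] at hd
  have n1 := hc.nodup_arc hinj (i + 1) (t := k - i) (by omega)
  have n2 := hc.nodup_arc hinj (k + 1) (t := ℓ - k + i) (by omega)
  have hh1 := head?_arc c (i + 1) (t := k - i) (by omega)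
  have hh2 := head?_arc c (k + 1) (t := ℓ - k + i) (by omega)
  have hl1 := getLast?_arc c (i + 1) (t := k - i) (by omega)
  have hl2 := getLast?_arc c (k + 1) (t := ℓ - k + i) (by omega)
  have hp := hc.2 i
  have hr : (arc c (i + 1) (k - i)).reverse.IsChain K.Adj := by
    rw [List.isChain_reverse]
    exact (isChain_arc hc.1 _ _).imp fun _ _ h => h.symm
  refine hasCycle_of_list
    (l := b :: ((arc c (i + 1) (k - i)).reverse ++ b' :: arc c (k + 1) (ℓ - k + i)))
    ?_ (by simp) ?_ ?_ ?_
  · simp [length_arc]; omega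
  · simp only [List.isChain_cons, List.isChain_append, isChain_arc hc.1, hr]
    simp [hh1, hh2, hl1, e1, h2, h3.symm, h4]
  · simp only [List.nodup_cons, List.nodup_append', List.nodup_reverse, n1, n2]
    simp [mem_arc, hb, hb', hbb, hd]
  · simp [List.getLast?_cons, List.getLast?_append, hl2, e2, hp, h1.symm]

lemma hasCycle_detour_two (hc : IsClosedSeq K ℓ c)
    (hinj : ∀ i < ℓ, ∀ j < ℓ, c i = c j → i = j)
    (hℓ : 3 ≤ ℓ) {i : ℕ} {a w a' : V} (ha : ∀ i, c i ≠ a)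
    (hw : ∀ i, c i ≠ w) (ha' : ∀ i, c i ≠ a') (haa : a ≠ a') (h1 : K.Adj a (c i))
    (h2 : K.Adj a w) (h3 : K.Adj w a') (h4 : K.Adj a' (c (i + 2))) : HasCycle K (ℓ + 2) := by
  have n1 := hc.nodup_arc hinj (i + 2) (t := ℓ - 1) (by omega)
  have hh1 := head?_arc c (i + 2) (t := ℓ - 1) (by omega)
  have hl1 := getLast?_arc c (i + 2) (t := ℓ - 1) (by omega)
  have e1 : i + 2 + (ℓ - 1) - 1 = i + ℓ := by omega
  have hp := hc.2 i
  refine hasCycle_of_list (l := a :: w :: a' :: arc c (i + 2) (ℓ - 1)) ?_ (by simp) ?_ ?_ ?_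
  · simp [length_arc]; omega
  · simp only [List.isChain_cons, isChain_arc hc.1]
    simp [hh1, h2, h3, h4]
  · simp only [List.nodup_cons, n1]
    simp [mem_arc, ha, ha', hw, haa, h2.ne, h3.ne]
  · simp [List.getLast?_cons, hl1, e1, hp, h1.symm]

lemma hasCycle_detour_three (hc : IsClosedSeq K ℓ c)
    (hinj : ∀ i < ℓ, ∀ j < ℓ, c i = c j → i = j)
    (hℓ : 3 ≤ ℓ) {i : ℕ} {a w w' a' : V} (ha : ∀ i, c i ≠ a)
    (hw : ∀ i, c i ≠ w) (hw' : ∀ i, c i ≠ w') (ha' : ∀ i, c i ≠ a') (haa : a ≠ a')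
    (haw : a ≠ w') (hwa : w ≠ a') (h1 : K.Adj a (c i)) (h2 : K.Adj a w) (h3 : K.Adj w w')
    (h4 : K.Adj w' a') (h5 : K.Adj a' (c (i + 3))) : HasCycle K (ℓ + 2) := by
  have n1 := hc.nodup_arc hinj (i + 3) (t := ℓ - 2) (by omega)
  have hh1 := head?_arc c (i + 3) (t := ℓ - 2) (by omega)
  have hl1 := getLast?_arc c (i + 3) (t := ℓ - 2) (by omega)
  have e1 : i + 3 + (ℓ - 2) - 1 = i + ℓ := by omega
  have hp := hc.2 i
  refine hasCycle_of_list (l := a :: w :: w' :: a' :: arc c (i + 3) (ℓ - 2)) ?_ (by simp) ?_ ?_ ?_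
  · simp [length_arc]; omega
  · simp only [List.isChain_cons, isChain_arc hc.1]
    simp [hh1, h2, h3, h4, h5]
  · simp only [List.nodup_cons, n1]
    simp [mem_arc, ha, ha', hw, hw', haa, haw, hwa, h2.ne, h3.ne, h4.ne]
  · simp [List.getLast?_cons, hl1, e1, hp, h1.symm]

end CycleExtension

lemma exists_isClosedSeq_of_walk {K : SimpleGraph V} {u : V} (w : K.Walk u u)
    (hw : 0 < w.length) : ∃ c, IsClosedSeq K w.length c := by
  refine ⟨fun i => w.getVert (i % w.length), fun i => ?_, fun i => by simp⟩
  have hi := Nat.mod_lt i hw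
  by_cases h : i % w.length + 1 = w.length
  · have h1 : (i + 1) % w.length = 0 := by
      rw [← Nat.mod_add_mod, h, Nat.mod_self]
    have h2 := w.adj_getVert_succ hi
    rw [h, w.getVert_length] at h2
    simpa [h1] using h2
  · have h1 : (i + 1) % w.length = i % w.length + 1 := by
      rw [← Nat.mod_add_mod]
      exact Nat.mod_eq_of_lt (by omega)
    simp only [h1]
    exact w.adj_getVert_succ hi

/-- A shortest odd closed walk is a cycle, and two of its vertices at suitable distance have no
common neighbour; hence large degrees force a short odd cycle. -/
lemma exists_short_odd_cycle [Fintype V] [DecidableEq V] {K : SimpleGraph V} [DecidableRel K.Adj]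
    (hcol : ¬ K.Colorable 2)
    (hdeg : ∀ a b, a ≠ b → Fintype.card V < 2 * (K.degree a + K.degree b)) :
    ∃ ℓ, 3 ≤ ℓ ∧ ℓ ≤ 7 ∧ Odd ℓ ∧ HasCycle K ℓ := by
  classical
  have hex : ∃ ℓ, Odd ℓ ∧ ∃ c, IsClosedSeq K ℓ c := by
    rw [two_colorable_iff_forall_loop_even] at hcol
    push Not at hcol
    obtain ⟨u, w, hw⟩ := hcol
    rw [Nat.not_even_iff_odd] at hw
    exact ⟨_, hw, exists_isClosedSeq_of_walk w hw.pos⟩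
  obtain ⟨ℓ, ⟨hodd, c, hc⟩, hmin⟩ : ∃ ℓ, (Odd ℓ ∧ ∃ c, IsClosedSeq K ℓ c) ∧
      ∀ k < ℓ, ¬ (Odd k ∧ ∃ c, IsClosedSeq K k c) :=
    ⟨Nat.find hex, Nat.find_spec hex, fun k hk => Nat.find_min hex hk⟩
  have harc : ∀ i s, s < ℓ → Odd s → c i ≠ c (i + s) := by
    intro i s hs hso h
    refine hmin s hs ⟨hso, ?_⟩
    have hl : arc c i s ≠ [] := by
      rw [← List.length_pos_iff, length_arc]
      exact hso.pos
    obtain ⟨c', hc', -⟩ := isClosedSeq_of_list hl (isChain_arc hc.1 i s) (by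
      have := hc.1 (i + s - 1)
      rw [Nat.sub_add_cancel (by have := hso.pos; omega), ← h] at this
      simpa [head?_arc c i hso.pos, getLast?_arc c i hso.pos] using this)
    rw [length_arc] at hc'
    exact ⟨c', hc'⟩
  have hcommon : ∀ i s w, s + 2 < ℓ → Odd s → K.Adj (c i) w → ¬ K.Adj (c (i + s)) w := by
    intro i s w hs hso h h'
    refine hmin (s + 2) hs ⟨by simpa [parity_simps] using hso, ?_⟩
    obtain ⟨c', hc', -⟩ := isClosedSeq_of_list (K := K) (l := w :: arc c i (s + 1)) (by simp) (by
      simp [List.isChain_cons, isChain_arc hc.1, head?_arc, h.symm]) (by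
      simp [List.getLast?_cons, getLast?_arc, h'])
    rw [List.length_cons, length_arc] at hc'
    exact ⟨c', hc'⟩
  have hcommon' : ∀ i s w, 2 < s → s < ℓ → Even s → K.Adj (c i) w → ¬ K.Adj (c (i + s)) w := by
    intro i s w hs hs' hse h h'
    refine hcommon (i + s) (ℓ - s) w (by omega) (Nat.Odd.sub_even hs'.le hodd hse) h' ?_
    rwa [show i + s + (ℓ - s) = i + ℓ by omega, hc.2]
  have h1 : ℓ ≠ 1 := by
    rintro rfl
    exact (hc.1 0).ne (hc.2 0).symm
  have hinj' : ∀ i j, i < j → j < ℓ → c i ≠ c j := by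
    intro i j hij hj h
    rcases Nat.even_or_odd (j - i) with he | ho
    · refine harc j (ℓ - (j - i)) (by omega) (Nat.Odd.sub_even (by omega) hodd he) ?_
      rw [show j + (ℓ - (j - i)) = i + ℓ by omega, hc.2, h]
    · refine harc i (j - i) (by omega) ho ?_
      rwa [show i + (j - i) = j by omega]
  refine ⟨ℓ, ?_, ?_, hodd, c, hc, ?_⟩
  · obtain ⟨k, rfl⟩ := hodd
    omega
  · by_contra! hlt
    have h9 : 9 ≤ ℓ := by
      obtain ⟨k, rfl⟩ := hodd
      omega
    have d : ∀ i j, (∀ w, K.Adj (c i) w → ¬ K.Adj (c j) w) →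
        Disjoint (K.neighborFinset (c i)) (K.neighborFinset (c j)) := by
      intro i j h
      rw [Finset.disjoint_left]
      simpa using h
    have d01 := d 0 1 fun w => hcommon 0 1 w (by omega) (by decide)
    have d04 := d 0 4 fun w => hcommon' 0 4 w (by omega) (by omega) (by decide)
    have d05 := d 0 5 fun w => hcommon 0 5 w (by omega) (by decide)
    have d14 := d 1 4 fun w => hcommon 1 3 w (by omega) (by decide)
    have d15 := d 1 5 fun w => hcommon' 1 4 w (by omega) (by omega) (by decide)
    have d45 := d 4 5 fun w => hcommon 4 1 w (by omega) (by decide)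
    have hle := Finset.card_le_univ ((K.neighborFinset (c 0) ∪ K.neighborFinset (c 1)) ∪
      (K.neighborFinset (c 4) ∪ K.neighborFinset (c 5)))
    rw [Finset.card_union_of_disjoint (by
      simp only [Finset.disjoint_union_left, Finset.disjoint_union_right]
      exact ⟨⟨d04, d14⟩, d05, d15⟩),
      Finset.card_union_of_disjoint d01, Finset.card_union_of_disjoint d45] at hle
    simp only [card_neighborFinset_eq_degree] at hle
    have q1 := hdeg _ _ (hinj' 0 1 (by omega) (by omega))
    have q2 := hdeg _ _ (hinj' 4 5 (by omega) (by omega))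
    omega
  · intro i hi j hj h
    rcases lt_trichotomy i j with hij | hij | hij
    · exact absurd h (hinj' i j hij hj)
    · exact hij
    · exact absurd h.symm (hinj' j i hij hi)

lemma two_mul_card_filter_le {ℓ : ℕ} (p : ℕ → Prop) [DecidablePred p] (hp : p ℓ ↔ p 0) :
    2 * ((Finset.range ℓ).filter p).card ≤
      ℓ + ((Finset.range ℓ).filter fun i => p i ∧ p (i + 1)).card := by
  have h1 : ((Finset.range ℓ).filter fun i => p (i + 1)).card = ((Finset.range ℓ).filter p).card := by
    simp only [Finset.card_filter]
    have h2 := Finset.sum_range_succ (fun i => if p i then 1 else 0) ℓ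
    rw [Finset.sum_range_succ'] at h2
    simp only [hp] at h2
    omega
  have h2 := Finset.card_union_add_card_inter ((Finset.range ℓ).filter p)
    ((Finset.range ℓ).filter fun i => p (i + 1))
  rw [← Finset.filter_and, ← Finset.filter_or] at h2
  have h3 := Finset.card_filter_le (Finset.range ℓ) fun i => p i ∨ p (i + 1)
  rw [Finset.card_range] at h3
  omega

/-- The core extension step: an odd cycle of moderate length `ℓ` yields one of length `ℓ + 2`. -/
lemma hasCycle_add_two [Fintype V] [DecidableEq V] {K : SimpleGraph V} [DecidableRel K.Adj]
    {n ℓ : ℕ} (hV : Fintype.card V ≤ 2 * n + 3) (hℓ : 3 ≤ ℓ) (hn : 2 * ℓ + 500 ≤ n)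
    (hpair : ∀ u v, u ≠ v → n + 1 ≤ (K.neighborFinset u ∪ K.neighborFinset v).card)
    (hdeg : ∀ v, ℓ + 20 ≤ K.degree v) (hcyc : HasCycle K ℓ) : HasCycle K (ℓ + 2) := by
  classical
  by_contra hno
  obtain ⟨c, hc, hinj⟩ := hcyc
  have hp : ∀ i, c (i + ℓ) = c i := hc.2
  set C : Finset V := (Finset.range ℓ).image c with hC
  have hCmem : ∀ i, c i ∈ C := fun i => by
    rw [← hc.mod i, hC]
    exact Finset.mem_image_of_mem _ (Finset.mem_range.2 (Nat.mod_lt _ (by omega)))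
  have hoff : ∀ {b}, b ∉ C → ∀ i, c i ≠ b := fun hb i h => hb (h ▸ hCmem i)
  have hCcard : C.card = ℓ := by
    rw [hC, Finset.card_image_of_injOn, Finset.card_range]
    intro i hi j hj h
    exact hinj i (by simpa using hi) j (by simpa using hj) h
  -- the cycle edges whose both ends are adjacent to `b`
  let E : V → Finset ℕ := fun b =>
    (Finset.range ℓ).filter fun i => K.Adj b (c i) ∧ K.Adj b (c (i + 1))
  have hE : ∀ b b', b ∉ C → b' ∉ C → b ≠ b' → ∀ i ∈ E b, ∀ k ∈ E b', i = k := by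
    intro b b' hb hb' hbb i hi k hk
    simp only [E, Finset.mem_filter, Finset.mem_range] at hi hk
    rcases lt_trichotomy i k with h | h | h
    · exact absurd (hasCycle_insert_insert hc hinj hbb (hoff hb) (hoff hb') h hk.1
        hi.2.1 hi.2.2 hk.2.1 hk.2.2) hno
    · exact h
    · exact absurd (hasCycle_insert_insert hc hinj hbb.symm (hoff hb') (hoff hb) h hi.1
        hk.2.1 hk.2.2 hi.2.1 hi.2.2) hno
  have hT : ∀ b b', b ∉ C → b' ∉ C → b ≠ b' →
      ((Finset.range ℓ).filter fun i => K.Adj b (c i) ∧ K.Adj b' (c (i + 1))).card ≤ 1 := by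
    intro b b' hb hb' hbb
    rw [Finset.card_le_one]
    intro i hi k hk
    simp only [Finset.mem_filter, Finset.mem_range] at hi hk
    rcases lt_trichotomy i k with h | h | h
    · exact absurd (hasCycle_cross hc hinj hbb (hoff hb) (hoff hb') h hk.1
        hi.2.1 hk.2.1 hi.2.2 hk.2.2) hno
    · exact h
    · exact absurd (hasCycle_cross hc hinj hbb (hoff hb) (hoff hb') h hi.1
        hk.2.1 hi.2.1 hk.2.2 hi.2.2) hno
  let O : Finset V := Finset.univ.filter fun b => b ∉ C ∧ (E b).card ≤ 1
  let X : Finset V := Finset.univ.filter fun b => b ∉ C ∧ ¬ (E b).card ≤ 1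
  have hO : ∀ {b}, b ∈ O → b ∉ C ∧ (E b).card ≤ 1 := fun hb => (Finset.mem_filter.1 hb).2
  have hXcard : X.card ≤ 1 := by
    rw [Finset.card_le_one]
    intro b hb b' hb'
    simp only [X, Finset.mem_filter, Finset.mem_univ, true_and, not_le,
      Finset.one_lt_card] at hb hb'
    by_contra hbb
    obtain ⟨hbC, i, hi, j, hj, hij⟩ := hb
    obtain ⟨hbC', k, hk, -⟩ := hb'
    exact hij ((hE b b' hbC hbC' hbb i hi k hk).trans (hE b b' hbC hbC' hbb j hj k hk).symm)
  have hOC : O.card + ℓ ≤ 2 * n + 3 := by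
    have : Disjoint O C := Finset.disjoint_left.2 fun b hb => (hO hb).1
    have h := Finset.card_le_univ (O ∪ C)
    rw [Finset.card_union_of_disjoint this, hCcard] at h
    omega
  have hcover : ∀ x, x ∈ O ∨ x ∈ C ∨ x ∈ X := by
    intro x
    simp only [O, X, Finset.mem_filter, Finset.mem_univ, true_and]
    tauto
  -- two vertices of `O` see together only about half of the cycle
  have hhalf : ∀ b ∈ O, ∀ b' ∈ O, b ≠ b' →
      2 * ((Finset.range ℓ).filter fun i => K.Adj b (c i) ∨ K.Adj b' (c i)).card ≤ ℓ + 4 := by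
    intro b hb b' hb' hbb
    have h0 := hp 0
    rw [zero_add] at h0
    have h1 := two_mul_card_filter_le (ℓ := ℓ) (fun i => K.Adj b (c i) ∨ K.Adj b' (c i))
      (by simp only [h0])
    have h2 : ((Finset.range ℓ).filter fun i => (K.Adj b (c i) ∨ K.Adj b' (c i)) ∧
        (K.Adj b (c (i + 1)) ∨ K.Adj b' (c (i + 1)))) ⊆ (E b ∪ E b') ∪
        (((Finset.range ℓ).filter fun i => K.Adj b (c i) ∧ K.Adj b' (c (i + 1))) ∪
        ((Finset.range ℓ).filter fun i => K.Adj b' (c i) ∧ K.Adj b (c (i + 1)))) := by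
      intro i
      simp only [E, Finset.mem_union, Finset.mem_filter]
      tauto
    have h3 := Finset.card_le_card h2
    have h4 := Finset.card_union_le (E b ∪ E b')
      (((Finset.range ℓ).filter fun i => K.Adj b (c i) ∧ K.Adj b' (c (i + 1))) ∪
        ((Finset.range ℓ).filter fun i => K.Adj b' (c i) ∧ K.Adj b (c (i + 1))))
    have h5 := Finset.card_union_le (E b) (E b')
    have h6 := Finset.card_union_le
      ((Finset.range ℓ).filter fun i => K.Adj b (c i) ∧ K.Adj b' (c (i + 1)))
      ((Finset.range ℓ).filter fun i => K.Adj b' (c i) ∧ K.Adj b (c (i + 1)))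
    have h7 := hT b b' (hO hb).1 (hO hb').1 hbb
    have h8 := hT b' b (hO hb').1 (hO hb).1 hbb.symm
    have h9 := (hO hb).2
    have h10 := (hO hb').2
    omega
  -- distinct representatives: two neighbours in `O` for each of seven cycle vertices
  obtain ⟨a, hainj, ha⟩ : ∃ a : Fin 7 × Fin 2 → V, Function.Injective a ∧
      ∀ j : Fin 7 × Fin 2, a j ∈ K.neighborFinset (c (j.1 : ℕ)) ∩ O := by
    rw [← Finset.all_card_le_biUnion_card_iff_exists_injective
      (fun j : Fin 7 × Fin 2 => K.neighborFinset (c j.1) ∩ O)]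
    intro s
    rcases s.eq_empty_or_nonempty with rfl | ⟨j, hj⟩
    · simp
    · have h1 : K.neighborFinset (c j.1) ∩ O ⊆
          s.biUnion fun j : Fin 7 × Fin 2 => K.neighborFinset (c j.1) ∩ O :=
        Finset.subset_biUnion_of_mem (fun j : Fin 7 × Fin 2 => K.neighborFinset (c j.1) ∩ O) hj
      have h2 : K.neighborFinset (c j.1) ⊆ (K.neighborFinset (c j.1) ∩ O) ∪ (C ∪ X) := by
        intro x hx
        have := hcover x
        simp only [Finset.mem_union, Finset.mem_inter]
        tauto
      have h3 := Finset.card_le_card h1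
      have h4 := Finset.card_le_card h2
      have h5 := Finset.card_union_le (K.neighborFinset (c j.1) ∩ O) (C ∪ X)
      have h6 := Finset.card_union_le C X
      have h7 := hdeg (c j.1)
      have h8 := Finset.card_le_univ s
      rw [card_neighborFinset_eq_degree] at h4
      simp only [Fintype.card_prod, Fintype.card_fin] at h8
      omega
  have haO : ∀ j, a j ∈ O := fun j => (Finset.mem_inter.1 (ha j)).2
  have hac : ∀ j, K.Adj (a j) (c j.1) := fun j => by
    have := (Finset.mem_inter.1 (ha j)).1
    rw [mem_neighborFinset] at this
    exact this.symm
  let P : Finset V := Finset.univ.image a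
  have hPcard : P.card ≤ 14 := Finset.card_image_le.trans (by simp)
  have haP : ∀ j, a j ∈ P := fun j => Finset.mem_image_of_mem _ (Finset.mem_univ _)
  let N : V → V → Finset V := fun u v => ((K.neighborFinset u ∪ K.neighborFinset v) ∩ O) \ P
  have hN : ∀ u ∈ O, ∀ v ∈ O, u ≠ v → 2 * n ≤ 2 * (N u v).card + ℓ + 32 := by
    intro u hu v hv huv
    have h1 : K.neighborFinset u ∪ K.neighborFinset v ⊆ (N u v ∪
        (((Finset.range ℓ).filter fun i => K.Adj u (c i) ∨ K.Adj v (c i)).image c)) ∪ (X ∪ P) := by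
      intro x hx
      have h2 := hcover x
      by_cases hxP : x ∈ P
      · exact Finset.mem_union_right _ (Finset.mem_union_right _ hxP)
      rcases h2 with h2 | h2 | h2
      · exact Finset.mem_union_left _ (Finset.mem_union_left _
          (Finset.mem_sdiff.2 ⟨Finset.mem_inter.2 ⟨hx, h2⟩, hxP⟩))
      · obtain ⟨i, hi, rfl⟩ := Finset.mem_image.1 h2
        refine Finset.mem_union_left _ (Finset.mem_union_right _ (Finset.mem_image_of_mem _ ?_))
        rw [Finset.mem_filter]
        exact ⟨hi, by simpa using hx⟩
      · exact Finset.mem_union_right _ (Finset.mem_union_left _ h2)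
    have h2 := Finset.card_le_card h1
    have h3 := Finset.card_union_le (N u v ∪
      (((Finset.range ℓ).filter fun i => K.Adj u (c i) ∨ K.Adj v (c i)).image c)) (X ∪ P)
    have h4 := Finset.card_union_le (N u v)
      (((Finset.range ℓ).filter fun i => K.Adj u (c i) ∨ K.Adj v (c i)).image c)
    have h5 := Finset.card_union_le X P
    have h6 : (((Finset.range ℓ).filter fun i => K.Adj u (c i) ∨ K.Adj v (c i)).image c).card ≤ _ :=
      Finset.card_image_le
    have h7 := hhalf u hu v hv huv
    have h8 := hpair u v huv
    omega
  let D : Fin 7 → Finset V := fun i => N (a (i, 0)) (a (i, 1))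
  have hDcard : ∀ i, 2 * n ≤ 2 * (D i).card + ℓ + 32 := fun i =>
    hN _ (haO _) _ (haO _) (hainj.ne (by simp))
  have hD : ∀ {i w}, w ∈ D i → w ∈ O ∧ w ∉ P ∧ ∃ e, K.Adj (a (i, e)) w := by
    intro i w hw
    simp only [D, N, Finset.mem_sdiff, Finset.mem_inter, Finset.mem_union,
      mem_neighborFinset] at hw
    exact ⟨hw.1.2, hw.2, hw.1.1.elim (fun h => ⟨0, h⟩) fun h => ⟨1, h⟩⟩
  have htwo : ∀ i j : Fin 7, (j : ℕ) = i + 2 → Disjoint (D i) (D j) := by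
    intro i j hij
    rw [Finset.disjoint_left]
    intro w hwi hwj
    obtain ⟨hwO, hwP, e, he⟩ := hD hwi
    obtain ⟨-, -, f, hf⟩ := hD hwj
    refine hno (hasCycle_detour_two hc hinj hℓ (hoff (hO (haO (i, e))).1) (hoff (hO hwO).1)
      (hoff (hO (haO (j, f))).1) (hainj.ne ?_) (hac (i, e)) he hf.symm ?_)
    · intro h
      rw [Prod.mk.injEq] at h
      omega
    · have := hac (j, f)
      rwa [hij] at this
  have hthree : ∀ i j : Fin 7, (j : ℕ) = i + 3 → ∀ w ∈ D i, ∀ w' ∈ D j, ¬ K.Adj w w' := by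
    intro i j hij w hw w' hw' hadj
    obtain ⟨hwO, hwP, e, he⟩ := hD hw
    obtain ⟨hwO', hwP', f, hf⟩ := hD hw'
    refine hno (hasCycle_detour_three hc hinj hℓ (hoff (hO (haO (i, e))).1) (hoff (hO hwO).1)
      (hoff (hO hwO').1) (hoff (hO (haO (j, f))).1) (hainj.ne ?_) (fun h => hwP' (h ▸ haP _))
      (fun h => hwP (h ▸ haP _)) (hac (i, e)) he hadj hf.symm ?_)
    · intro h
      rw [Prod.mk.injEq] at h
      omega
    · have := hac (j, f)
      rwa [hij] at this
  have hDO : ∀ i, D i ⊆ O := fun i w hw => (hD hw).1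
  obtain ⟨w, hw, w', hw', hww⟩ := Finset.one_lt_card.1 (show 1 < (D 3).card by
    have := hDcard 3
    omega)
  have hsep : Disjoint (N w w') (D 0 ∪ D 6) := by
    rw [Finset.disjoint_left]
    intro x hx hx'
    simp only [N, Finset.mem_sdiff, Finset.mem_inter, Finset.mem_union,
      mem_neighborFinset] at hx
    rcases Finset.mem_union.1 hx' with h | h
    · rcases hx.1.1 with h1 | h1
      · exact hthree 0 3 rfl x h w hw h1.symm
      · exact hthree 0 3 rfl x h w' hw' h1.symm
    · rcases hx.1.1 with h1 | h1
      · exact hthree 3 6 rfl w hw x h h1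
      · exact hthree 3 6 rfl w' hw' x h h1
  have hNO : N w w' ⊆ O := fun x hx => (Finset.mem_inter.1 (Finset.mem_sdiff.1 hx).1).2
  have k1 := hN w (hDO 3 hw) w' (hDO 3 hw') hww
  have k2 := Finset.card_le_card (Finset.union_subset hNO
    (Finset.union_subset (hDO 0) (hDO 6)))
  rw [Finset.card_union_of_disjoint hsep] at k2
  have k3 := Finset.card_union_add_card_inter (D 0) (D 6)
  have k4 : D 0 ∩ D 6 ∪ D 4 ∪ D 2 ⊆ O := by
    exact Finset.union_subset (Finset.union_subset
      (Finset.inter_subset_left.trans (hDO 0)) (hDO 4)) (hDO 2)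
  have d1 : Disjoint (D 0 ∩ D 6) (D 4) :=
    (htwo 4 6 rfl).symm.mono_left Finset.inter_subset_right
  have d2 : Disjoint (D 0 ∩ D 6 ∪ D 4) (D 2) := Finset.disjoint_union_left.2
    ⟨(htwo 0 2 rfl).mono_left Finset.inter_subset_left, (htwo 2 4 rfl).symm⟩
  have k5 := Finset.card_le_card k4
  rw [Finset.card_union_of_disjoint d2, Finset.card_union_of_disjoint d1] at k5
  have q0 := hDcard 0
  have q2 := hDcard 2
  have q4 := hDcard 4
  have q6 := hDcard 6
  omega

/-- In a graph which is not bipartite and in which any two vertices dominate more than half of the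
graph, large minimum degree forces all odd cycles of moderate length at least seven. -/
lemma hasCycle_of_le_degree [Fintype V] [DecidableEq V] {K : SimpleGraph V} [DecidableRel K.Adj]
    {n m : ℕ} (hm : 7 ≤ m) (hodd : Odd m) (hn : 2 * m + 496 ≤ n)
    (hV : Fintype.card V ≤ 2 * n + 3)
    (hpair : ∀ u v, u ≠ v → n + 1 ≤ (K.neighborFinset u ∪ K.neighborFinset v).card)
    (hdeg : ∀ v, m + 20 ≤ K.degree v) (hcol : ¬ K.Colorable 2)
    (hsum : ∀ a b, a ≠ b → Fintype.card V < 2 * (K.degree a + K.degree b)) : HasCycle K m := by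
  obtain ⟨ℓ, h3, h7, hℓ, hcyc⟩ := exists_short_odd_cycle hcol hsum
  have key : ∀ t, ℓ + 2 * t ≤ m → HasCycle K (ℓ + 2 * t) := by
    intro t
    induction t with
    | zero => exact fun _ => hcyc
    | succ t ih =>
      intro ht
      exact hasCycle_add_two (ℓ := ℓ + 2 * t) hV (by omega) (by omega) hpair
        (fun v => le_trans (by omega) (hdeg v)) (ih (by omega))
  obtain ⟨a, rfl⟩ := hℓ
  obtain ⟨b, rfl⟩ := hodd
  have := key (b - a) (by omega)
  rwa [show 2 * a + 1 + 2 * (b - a) = 2 * b + 1 by omega] at this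

/-- The vertices other than `u` and `w` adjacent to neither of them. -/
def commonNonneighbors [Fintype V] [DecidableEq V] (K : SimpleGraph V) [DecidableRel K.Adj]
    (u w : V) : Finset V :=
  Finset.univ.filter fun x => x ≠ u ∧ x ≠ w ∧ ¬ K.Adj u x ∧ ¬ K.Adj w x

lemma mem_commonNonneighbors [Fintype V] [DecidableEq V] {K : SimpleGraph V} [DecidableRel K.Adj]
    {u w x : V} : x ∈ commonNonneighbors K u w ↔
      x ≠ u ∧ x ≠ w ∧ ¬ K.Adj u x ∧ ¬ K.Adj w x := by
  simp [commonNonneighbors]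

lemma card_le_card_neighborFinset_union [Fintype V] [DecidableEq V] (K : SimpleGraph V)
    [DecidableRel K.Adj] (u w : V) :
    Fintype.card V ≤
      (K.neighborFinset u ∪ K.neighborFinset w).card + (commonNonneighbors K u w).card + 2 := by
  have h : (Finset.univ : Finset V) ⊆
      (K.neighborFinset u ∪ K.neighborFinset w) ∪ commonNonneighbors K u w ∪ {u, w} := by
    intro x _
    simp only [Finset.mem_union, mem_neighborFinset, mem_commonNonneighbors, Finset.mem_insert,
      Finset.mem_singleton]
    tauto
  have h1 := Finset.card_le_card h
  have h2 := Finset.card_union_le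
    ((K.neighborFinset u ∪ K.neighborFinset w) ∪ commonNonneighbors K u w) {u, w}
  have h3 := Finset.card_union_le (K.neighborFinset u ∪ K.neighborFinset w)
    (commonNonneighbors K u w)
  have h4 := Finset.card_le_two (a := u) (b := w)
  rw [Finset.card_univ] at h1
  omega

lemma exists_indep_of_colorable_two [Fintype V] [DecidableEq V] {K : SimpleGraph V}
    (h : K.Colorable 2) :
    ∃ X : Finset V, Fintype.card V ≤ 2 * X.card ∧ ∀ x ∈ X, ∀ y ∈ X, ¬ K.Adj x y := by
  obtain ⟨col⟩ := h
  have h1 : ∀ i : Fin 2, ∀ x ∈ Finset.univ.filter (fun x => col x = i),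
      ∀ y ∈ Finset.univ.filter (fun x => col x = i), ¬ K.Adj x y := by
    intro i x hx y hy hxy
    rw [Finset.mem_filter] at hx hy
    exact col.valid hxy (hx.2.trans hy.2.symm)
  have h2 : (Finset.univ : Finset V) ⊆
      Finset.univ.filter (fun x => col x = 0) ∪ Finset.univ.filter (fun x => col x = 1) := by
    intro x _
    simp only [Finset.mem_union, Finset.mem_filter, Finset.mem_univ, true_and]
    generalize col x = i
    fin_cases i <;> simp
  have h3 := (Finset.card_le_card h2).trans (Finset.card_union_le _ _)
  rw [Finset.card_univ] at h3
  rcases le_total (Finset.univ.filter fun x => col x = 0).card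
    (Finset.univ.filter fun x => col x = 1).card with h4 | h4
  · exact ⟨_, by omega, h1 1⟩
  · exact ⟨_, by omega, h1 0⟩

lemma card_sub_two_le_commonNonneighbors [Fintype V] [DecidableEq V] {K : SimpleGraph V}
    [DecidableRel K.Adj] {X : Finset V} (hX : ∀ x ∈ X, ∀ y ∈ X, ¬ K.Adj x y) {u w : V}
    (hu : u ∈ X) (hw : w ∈ X) :
    X \ {u, w} ⊆ commonNonneighbors K u w ∧ X.card ≤ (X \ {u, w}).card + 2 := by
  refine ⟨fun x hx => ?_, ?_⟩
  · simp only [Finset.mem_sdiff, Finset.mem_insert, Finset.mem_singleton, not_or] at hx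
    exact mem_commonNonneighbors.2 ⟨hx.2.1, hx.2.2, hX u hu x hx.1, hX w hw x hx.1⟩
  · have h1 := Finset.card_le_card_sdiff_add_card (s := X) (t := {u, w})
    have h2 := Finset.card_le_two (a := u) (b := w)
    omega

/-- A graph on `2n + 3` vertices in which any two vertices have fewer than `n` common
non-neighbours contains all odd cycles of moderate length at least seven. -/
lemma hasCycle_of_commonNonneighbors [Fintype V] [DecidableEq V] {K : SimpleGraph V}
    [DecidableRel K.Adj] {n m : ℕ} (hm : 7 ≤ m) (hodd : Odd m) (hn : 2 * m + 499 ≤ n)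
    (hV : Fintype.card V = 2 * n + 3)
    (hK : ∀ u w, u ≠ w → (commonNonneighbors K u w).card < n) : HasCycle K m := by
  have hpair : ∀ u w, u ≠ w → n + 2 ≤ (K.neighborFinset u ∪ K.neighborFinset w).card := by
    intro u w huw
    have := card_le_card_neighborFinset_union K u w
    have := hK u w huw
    omega
  have hsum : ∀ u w, u ≠ w → n + 2 ≤ K.degree u + K.degree w := fun u w huw =>
    (hpair u w huw).trans ((Finset.card_union_le _ _).trans (by simp))
  by_cases hdeg : ∀ v, m + 20 ≤ K.degree v
  · refine hasCycle_of_le_degree hm hodd (by omega) hV.le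
      (fun u v huv => (Nat.le_succ _).trans (hpair u v huv)) hdeg ?_ ?_
    · intro hcol
      obtain ⟨X, hXc, hX⟩ := exists_indep_of_colorable_two hcol
      obtain ⟨u, hu, w, hw, huw⟩ := Finset.one_lt_card.1 (show 1 < X.card by omega)
      obtain ⟨h1, h2⟩ := card_sub_two_le_commonNonneighbors hX hu hw
      have := Finset.card_le_card h1
      have := hK u w huw
      omega
    · intro a b hab
      have := hsum a b hab
      omega
  · push Not at hdeg
    obtain ⟨z, hz⟩ := hdeg
    let S : Set V := {x | x ≠ z}
    let L : SimpleGraph S := K.induce S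
    have hLcard : Fintype.card S = 2 * n + 2 := by
      have : Fintype.card S = Fintype.card V - 1 := Set.card_ne_eq z
      omega
    have hLK : ∀ u w : S, (commonNonneighbors L u w).map (Function.Embedding.subtype _) ⊆
        commonNonneighbors K u w := by
      intro u w x hx
      obtain ⟨y, hy, rfl⟩ := Finset.mem_map.1 hx
      rw [mem_commonNonneighbors] at hy ⊢
      exact ⟨fun h => hy.1 (Subtype.ext h), fun h => hy.2.1 (Subtype.ext h), hy.2.2.1, hy.2.2.2⟩
    have hL : ∀ u w : S, u ≠ w → (commonNonneighbors L u w).card < n := by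
      intro u w huw
      have h1 := Finset.card_le_card (hLK u w)
      rw [Finset.card_map] at h1
      exact h1.trans_lt (hK u w fun h => huw (Subtype.ext h))
    have hdegL : ∀ v : S, K.degree v ≤ L.degree v + 1 := by
      intro v
      have h1 : K.neighborFinset v ⊆
          insert z ((L.neighborFinset v).map (Function.Embedding.subtype _)) := by
        intro x hx
        by_cases hxz : x = z
        · simp [hxz]
        · refine Finset.mem_insert_of_mem (Finset.mem_map.2 ⟨⟨x, hxz⟩, ?_, rfl⟩)
          rw [mem_neighborFinset] at hx ⊢
          exact hx
      have h2 := (Finset.card_le_card h1).trans (Finset.card_insert_le _ _)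
      rwa [Finset.card_map, card_neighborFinset_eq_degree, card_neighborFinset_eq_degree] at h2
    have hdegL' : ∀ v : S, n ≤ L.degree v + m + 18 := by
      intro v
      have := hdegL v
      have := hsum v z v.2
      omega
    refine HasCycle.map (K := L) Subtype.val Subtype.val_injective (fun x y h => h) ?_
    refine hasCycle_of_le_degree (n := n) hm hodd (by omega) (by omega) ?_ ?_ ?_ ?_
    · intro u w huw
      have := card_le_card_neighborFinset_union L u w
      have := hL u w huw
      omega
    · intro v
      have := hdegL' v
      omega
    · intro hcol
      obtain ⟨X, hXc, hX⟩ := exists_indep_of_colorable_two hcol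
      have hfar : (X.filter fun x : S => ¬ K.Adj z x).card ≤ 1 := by
        rw [Finset.card_le_one]
        intro u hu w hw
        rw [Finset.mem_filter] at hu hw
        by_contra huw
        obtain ⟨h1, h2⟩ := card_sub_two_le_commonNonneighbors hX hu.1 hw.1
        have h3 : insert z ((X \ {u, w}).map (Function.Embedding.subtype _)) ⊆
            commonNonneighbors K u w := by
          refine Finset.insert_subset ?_ ((Finset.map_subset_map.2 h1).trans (hLK u w))
          exact mem_commonNonneighbors.2 ⟨Ne.symm u.2, Ne.symm w.2, fun h => hu.2 h.symm,
            fun h => hw.2 h.symm⟩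
        have h4 := Finset.card_le_card h3
        rw [Finset.card_insert_of_notMem, Finset.card_map] at h4
        · have := hK u w fun h => huw (Subtype.ext h)
          omega
        · intro h
          obtain ⟨y, -, hy⟩ := Finset.mem_map.1 h
          exact y.2 hy
      have hnear : (X.filter fun x : S => K.Adj z x).card ≤ K.degree z := by
        rw [← card_neighborFinset_eq_degree, ← Finset.card_map (Function.Embedding.subtype _)]
        refine Finset.card_le_card fun x hx => ?_
        obtain ⟨y, hy, rfl⟩ := Finset.mem_map.1 hx
        rw [mem_neighborFinset]
        exact (Finset.mem_filter.1 hy).2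
      have := Finset.card_filter_add_card_filter_not (s := X) fun x : S => K.Adj z x
      omega
    · intro a b _
      have := hdegL' a
      have := hdegL' b
      omega

lemma containsCopy_completeBipartiteGraph_two {G : SimpleGraph V} {n : ℕ} {u w : V} (huw : u ≠ w)
    {T : Finset V} (hT : n ≤ T.card) (hTu : ∀ x ∈ T, G.Adj u x) (hTw : ∀ x ∈ T, G.Adj w x) :
    ContainsCopy G (completeBipartiteGraph (Fin 2) (Fin n)) := by
  let g : Fin n → V := fun i => T.equivFin.symm (Fin.castLE hT i)
  have hg : Function.Injective g := fun i j h =>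
    Fin.castLE_injective hT (T.equivFin.symm.injective (Subtype.ext h))
  have hadj : ∀ (i : Fin 2) (j : Fin n), G.Adj (![u, w] i) (g j) := by
    intro i j
    have hj : g j ∈ T := (T.equivFin.symm (Fin.castLE hT j)).2
    fin_cases i
    · exact hTu _ hj
    · exact hTw _ hj
  refine ⟨⟨Sum.elim ![u, w] g, ?_⟩, ?_⟩
  · rintro (a | a) (b | b) h
    · simp at h
    · exact hadj a b
    · exact (hadj b a).symm
    · simp at h
  · refine Function.Injective.sumElim ?_ hg fun i j => (hadj i j).ne
    intro i j h
    fin_cases i <;> fin_cases j <;> simp_all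

lemma containsCopy_wheelGraph {G : SimpleGraph V} {m : ℕ} {v : V} {c : ℕ → V}
    (hc : IsClosedSeq G m c) (hinj : ∀ i < m, ∀ j < m, c i = c j → i = j)
    (hv : ∀ i, G.Adj v (c i)) : ContainsCopy G (wheelGraph m) := by
  have hadj : ∀ i j : Fin m, (cycleGraph m).Adj i j → G.Adj (c i) (c j) := by
    have key : ∀ i j : Fin m, (i - j : Fin m).val = 1 → G.Adj (c j) (c i) := by
      intro i j h
      have h1 : (i : ℕ) = (j + 1) % m := by
        have hj := j.2
        have hi := i.2
        rw [Fin.sub_def] at h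
        simp only at h
        have h2 := Nat.div_add_mod (m - j + i) m
        rw [h] at h2
        have h3 : (m - j + i) / m < 2 := by
          rw [Nat.div_lt_iff_lt_mul (by omega)]
          omega
        generalize (m - j + i) / m = q at h2 h3
        interval_cases q
        · rw [mul_zero] at h2
          rw [show (j : ℕ) + 1 = m by omega, Nat.mod_self]
          omega
        · rw [mul_one] at h2
          rw [Nat.mod_eq_of_lt (by omega)]
          omega
      rw [h1, hc.mod]
      exact hc.1 _
    intro i j h
    rw [cycleGraph_adj'] at h
    exact h.elim (fun h => (key i j h).symm) fun h => key j i h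
  refine ⟨⟨fun x => x.elim v fun i => c i, ?_⟩, ?_⟩
  · rintro (_ | i) (_ | j) h
    · exact absurd rfl h.ne
    · exact hv j
    · exact (hv i).symm
    · rw [wheelGraph, fromRel_adj] at h
      obtain ⟨-, (h | ⟨a, b, ha, hb, h⟩) | h | ⟨a, b, ha, hb, h⟩⟩ := h
      · exact absurd h (Option.some_ne_none _)
      · cases ha
        cases hb
        exact hadj _ _ h
      · exact absurd h (Option.some_ne_none _)
      · cases ha
        cases hb
        exact (hadj _ _ h).symm
  · rintro (_ | i) (_ | j) h
    · rfl
    · exact absurd h (hv j).ne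
    · exact absurd h (hv i).ne'
    · exact congrArg some (Fin.ext (hinj i i.2 j j.2 h))

end

/-- Let `m ≥ 7` be odd and `n ≥ 2m + 499`, `n ≥ 3493`. If `G` is a graph on `3n+4` vertices
containing no copy of `K_{2,n}` whose complement contains no copy of `W_m`, then
`Δ(G̅) ≤ 2n + 2`. -/
theorem statement4 (n m : ℕ) (hm7 : 7 ≤ m) (hmodd : Odd m)
    (hn1 : 2 * m + 499 ≤ n) (hn2 : 3493 ≤ n)
    (G : SimpleGraph (Fin (3 * n + 4))) [DecidableRel G.Adj]
    (hG : ¬ ContainsCopy G (completeBipartiteGraph (Fin 2) (Fin n)))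
    (hGc : ¬ ContainsCopy Gᶜ (wheelGraph m)) :
    Gᶜ.maxDegree ≤ 2 * n + 2 := by
  classical
  obtain ⟨v, hv⟩ := Gᶜ.exists_maximal_degree_vertex
  rw [hv]
  by_contra! hlt
  rw [← card_neighborFinset_eq_degree] at hlt
  obtain ⟨s, hs, hscard⟩ := Finset.exists_subset_card_eq (show 2 * n + 3 ≤ _ from hlt)
  have hsv : ∀ x ∈ s, Gᶜ.Adj v x := fun x hx => (mem_neighborFinset _ _ _).1 (hs hx)
  let K : SimpleGraph s := Gᶜ.induce (s : Set (Fin (3 * n + 4)))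
  have hK : ∀ u w : s, u ≠ w → (commonNonneighbors K u w).card < n := by
    intro u w huw
    by_contra! hle
    have hadj : ∀ a x : s, x ≠ a → ¬ K.Adj a x → G.Adj a x := by
      intro a x hxa h
      by_contra hG
      exact h ((compl_adj _ _ _).2 ⟨fun h => hxa (Subtype.ext h).symm, hG⟩)
    refine hG (containsCopy_completeBipartiteGraph_two (u := (u : Fin (3 * n + 4))) (w := w)
      (fun h => huw (Subtype.ext h))
      (T := (commonNonneighbors K u w).map (Function.Embedding.subtype _)) ?_ ?_ ?_)
    · rwa [Finset.card_map]
    · intro x hx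
      obtain ⟨y, hy, rfl⟩ := Finset.mem_map.1 hx
      rw [mem_commonNonneighbors] at hy
      exact hadj u y hy.1 hy.2.2.1
    · intro x hx
      obtain ⟨y, hy, rfl⟩ := Finset.mem_map.1 hx
      rw [mem_commonNonneighbors] at hy
      exact hadj w y hy.2.1 hy.2.2.2
  obtain ⟨c, hc, hinj⟩ := hasCycle_of_commonNonneighbors (K := K) hm7 hmodd hn1 (by simpa) hK
  exact hGc (containsCopy_wheelGraph (v := v) (c := fun i => (c i : Fin (3 * n + 4)))
    ⟨fun i => hc.1 i, fun i => congrArg Subtype.val (hc.2 i)⟩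
    (fun i hi j hj h => hinj i hi j hj (Subtype.ext h)) fun i => hsv _ (c i).2)
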